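/- Fix a real number p with 0 < p < 1 and set q = 1 - p. Let (U_n)_{n≥0} be an i.i.d. sequence of uniform random variables on [0,1], and define the 1-excited random walk with reflecting origin (X_n) on the nonnegative integers by X_0 = 0 and, for n ≥ 0: if n = 0 or X_n > max{X_m : m < n} (the walk currently sits on a never-before-visited site, which contains a cookie), then X_{n+1} = X_n + 1 if U_n < p and X_{n+1} = max(X_n - 1, 0) otherwise; if the current site has been visited before (no cookie), then X_{n+1} = X_n + 1 if U_n < 1/2 and X_{n+1} = max(X_n - 1, 0) otherwise. For each integer n ≥ 1 let t_n = inf{m ≥ 0 : X_m = n} be the first time the walk hits the last cookie at site n. Then t_n is almost surely finite and E[t_n] = 2q n² + n. -/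

import Mathlib

open MeasureTheory ProbabilityTheory

namespace ExcWalk

/-- state: position, running maximum, freshness of the current site -/
abbrev St := ℕ × ℕ × Bool

/-- the state after moving to `x` -/
def move (s : St) (x : ℕ) : St := (x, max s.2.1 x, decide (s.2.1 < x))

/-- expected remaining time from a fresh site `M`, target `n` -/
noncomputable def F (p : ℝ) (n M : ℕ) : ℝ :=
  ((n : ℝ) - M) + 2 * (1 - p) * ((n : ℝ) ^ 2 - (M : ℝ) ^ 2)

/-- expected remaining time from a state -/
noncomputable def h (p : ℝ) (n : ℕ) (s : St) : ℝ :=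
  if s.2.1 < n then
    (if s.2.2 = true then F p n s.2.1
     else ((s.2.1 : ℝ) + 1) * (s.2.1 + 2) - (s.1 : ℝ) * (s.1 + 1) + F p n (s.2.1 + 1))
  else 0

/-- probability of a step to the right -/
noncomputable def c (p : ℝ) (s : St) : ℝ := if s.2.2 = true then p else 1 / 2

/-- invariant of reachable states -/
def Inv (s : St) : Prop := s.1 ≤ s.2.1 ∧ (s.2.2 = true → s.1 = s.2.1)

lemma inv_move (s : St) (x : ℕ) : Inv (move s x) := by
  constructor
  · simp [move]
  · simp only [move, decide_eq_true_eq]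
    intro hx
    omega

/-- survival indicator -/
noncomputable def sv (n : ℕ) (s : St) : ℝ := if s.2.1 < n then 1 else 0

lemma harmonic (p : ℝ) (n : ℕ) (s : St) (hs : Inv s) :
    h p n (move s (s.1 - 1)) + (h p n (move s (s.1 + 1)) - h p n (move s (s.1 - 1))) * c p s
      = h p n s - sv n s := by
  obtain ⟨x, M, b⟩ := s
  obtain ⟨h1, h2⟩ := hs
  simp only at h1 h2
  have e1 : max M (x - 1) = M := by omega
  have e2 : ¬ (M < x - 1) := by omega
  have hdn : move (x, M, b) (x - 1) = (x - 1, M, false) := by simp [move, e1, e2]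
  have hcast : ((x - 1 : ℕ) : ℝ) * ((x - 1 : ℕ) + 1) = (x : ℝ) * (x - 1) := by
    rcases x with _ | x
    · simp
    · simp; ring
  simp only
  rw [hdn]
  by_cases hMn : M < n
  swap
  · have : ¬ (max M (x + 1) < n) := by omega
    simp [move, h, sv, hMn, this]
  have hh : h p n (x - 1, M, false)
      = ((M : ℝ) + 1) * (M + 2) - (x : ℝ) * (x - 1) + F p n (M + 1) := by
    simp [h, hMn, hcast]
  rw [hh]
  rcases Nat.lt_or_ge x M with hx | hx
  · have hb : b = false := by
      by_contra hb
      have := h2 (by simpa using hb)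
      omega
    subst hb
    have hup : move (x, M, false) (x + 1) = (x + 1, M, false) := by
      simp only [move, Prod.mk.injEq, decide_eq_false_iff_not, true_and]
      omega
    rw [hup]
    simp [h, c, sv, hMn]
    ring
  · have hxM : x = M := by omega
    subst hxM
    have hup : move (x, x, b) (x + 1) = (x + 1, x + 1, true) := by
      simp [move]
    have hk : h p n (x + 1, x + 1, true) = F p n (x + 1) := by
      simp only [h]
      by_cases hn : x + 1 < n
      · simp [hn]
      · have : n = x + 1 := by omega
        subst this
        simp [F]
    rw [hup, hk]
    cases b
    · simp [h, c, sv, hMn, F]; ring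
    · simp [h, c, sv, hMn, F]; ring

lemma h_bounds (p : ℝ) (hp0 : 0 < p) (hp1 : p < 1) (n : ℕ) (s : St) (hs : Inv s) :
    0 ≤ h p n s ∧ h p n s ≤ (((n : ℝ) + 1) * (n + 2) + n + 2 * (n : ℝ) ^ 2) * sv n s := by
  obtain ⟨x, M, b⟩ := s
  obtain ⟨h1, -⟩ := hs
  simp only at h1
  simp only [h, sv]
  by_cases hMn : M < n
  swap
  · simp [hMn]
  have hF : ∀ M : ℕ, M ≤ n → 0 ≤ F p n M ∧ F p n M ≤ n + 2 * (n : ℝ) ^ 2 := by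
    intro M hM
    have hM' : (M : ℝ) ≤ n := by exact_mod_cast hM
    have hM0 : (0 : ℝ) ≤ M := by positivity
    have hsq : (M : ℝ) ^ 2 ≤ (n : ℝ) ^ 2 := by gcongr
    have hd : 0 ≤ (n : ℝ) ^ 2 - (M : ℝ) ^ 2 := by linarith
    have hq : 0 ≤ 1 - p := by linarith
    have h3 : 0 ≤ (1 - p) * ((n : ℝ) ^ 2 - (M : ℝ) ^ 2) := by positivity
    have h4 : 0 ≤ p * ((n : ℝ) ^ 2 - (M : ℝ) ^ 2) := by positivity
    unfold F
    constructor <;> nlinarith [sq_nonneg (M : ℝ)]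
  simp only [hMn, if_true, mul_one]
  have hxM : (x : ℝ) ≤ M := by exact_mod_cast h1
  have hMn' : (M : ℝ) ≤ n := by exact_mod_cast hMn.le
  have hx0 : (0 : ℝ) ≤ x := by positivity
  have hA := hF M hMn.le
  have hB := hF (M + 1) hMn
  have h5 : (0 : ℝ) ≤ ((n : ℝ) + 1) * (n + 2) := by positivity
  split_ifs
  · constructor <;> linarith [hA.1, hA.2]
  · have h6 : ((M : ℝ) + 1) * (M + 2) ≤ ((n : ℝ) + 1) * (n + 2) := by gcongr
    have h7 : (x : ℝ) * (x + 1) ≤ ((M : ℝ) + 1) * (M + 2) := by gcongr <;> linarith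
    have h8 : 0 ≤ (x : ℝ) * (x + 1) := by positivity
    constructor <;> linarith [hB.1, hB.2]

lemma h_abs (p : ℝ) (hp0 : 0 < p) (hp1 : p < 1) (n : ℕ) (s : St) (hs : Inv s) :
    |h p n s| ≤ ((n : ℝ) + 1) * (n + 2) + n + 2 * (n : ℝ) ^ 2 := by
  obtain ⟨h1, h2⟩ := h_bounds p hp0 hp1 n s hs
  rw [abs_of_nonneg h1]
  refine h2.trans ?_
  have : (0 : ℝ) ≤ ((n : ℝ) + 1) * (n + 2) + n + 2 * (n : ℝ) ^ 2 := by positivity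
  unfold sv
  split_ifs
  · simp
  · simpa using this

section prob
variable {Ω : Type*}

/-- the state process -/
noncomputable def S (p : ℝ) (U : ℕ → Ω → ℝ) : ℕ → Ω → St
  | 0, _ => (0, 0, true)
  | k + 1, ω =>
    if U k ω < c p (S p U k ω) then move (S p U k ω) ((S p U k ω).1 + 1)
    else move (S p U k ω) ((S p U k ω).1 - 1)

lemma inv_S (p : ℝ) (U : ℕ → Ω → ℝ) (k : ℕ) (ω : Ω) : Inv (S p U k ω) := by
  cases k with
  | zero => simp [S, Inv]
  | succ k =>
    simp only [S]
    split_ifs <;> exact inv_move _ _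

lemma S_spec (p : ℝ) (U : ℕ → Ω → ℝ) (X : ℕ → Ω → ℕ) (hX0 : ∀ ω, X 0 ω = 0)
    (hXstep : ∀ n ω, X (n + 1) ω =
      if n = 0 ∨ ∀ m < n, X m ω < X n ω then
        (if U n ω < p then X n ω + 1 else X n ω - 1)
      else
        (if U n ω < 1 / 2 then X n ω + 1 else X n ω - 1)) (ω : Ω) (k : ℕ) :
    (S p U k ω).1 = X k ω ∧ (∀ m ≤ k, X m ω ≤ (S p U k ω).2.1) ∧
    (∀ j ≤ (S p U k ω).2.1, ∃ m ≤ k, X m ω = j) ∧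
    ((S p U k ω).2.2 = true ↔ (k = 0 ∨ ∀ m < k, X m ω < X k ω)) := by
  induction k with
  | zero => simp [S, hX0]
  | succ k ih =>
    obtain ⟨i1, i2, i3, i4⟩ := ih
    have hinv := inv_S p U k ω
    set s := S p U k ω with hs
    have hSX : S p U (k + 1) ω = move s (X (k + 1) ω) ∧ X (k + 1) ω ≤ X k ω + 1 := by
      rw [hXstep]
      simp only [S, ← hs, c]
      by_cases hb : s.2.2 = true
      · have hb' := i4.1 hb
        rw [if_pos hb, if_pos hb', i1]
        split_ifs
        · simp
        · simp; omega
      · have hb' := fun hh => hb (i4.2 hh)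
        rw [if_neg hb, if_neg hb', i1]
        split_ifs
        · simp
        · simp; omega
    obtain ⟨hS, hle⟩ := hSX
    rw [hS]
    obtain ⟨j1, j2⟩ := hinv
    refine ⟨rfl, ?_, ?_, ?_⟩
    · intro m hm
      simp only [move]
      rcases Nat.lt_or_ge k m with hm' | hm'
      · have : m = k + 1 := by omega
        subst this
        exact le_max_right _ _
      · exact (i2 m hm').trans (le_max_left _ _)
    · intro j hj
      simp only [move] at hj
      rcases Nat.lt_or_ge s.2.1 j with hj' | hj'
      · exact ⟨k + 1, le_rfl, by omega⟩
      · obtain ⟨m, hm, he⟩ := i3 j hj'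
        exact ⟨m, by omega, he⟩
    · simp only [move, decide_eq_true_eq]
      constructor
      · intro hlt
        right
        intro m hm
        exact (i2 m (by omega)).trans_lt hlt
      · rintro (h0 | hall)
        · omega
        · obtain ⟨m, hm, he⟩ := i3 s.2.1 le_rfl
          have := hall m (by omega)
          omega

lemma S_meas [MeasurableSpace Ω] (p : ℝ) (U : ℕ → Ω → ℝ) (k : ℕ) :
    Measurable[⨆ i ∈ Set.Iio k, MeasurableSpace.comap (U i) inferInstance] (S p U k) := by
  induction k with
  | zero => exact @measurable_const _ _ _ (_) _
  | succ k ih =>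
    set m' := ⨆ i ∈ Set.Iio (k + 1), MeasurableSpace.comap (U i) inferInstance with hm'
    have h1 : Measurable[m'] (S p U k) := by
      refine ih.mono ?_ le_rfl
      exact biSup_mono (fun i hi => lt_trans hi (Nat.lt_succ_self k))
    have h2 : Measurable[m'] (U k) := by
      have : Measurable[MeasurableSpace.comap (U k) inferInstance] (U k) := comap_measurable _
      refine this.mono ?_ le_rfl
      exact le_biSup (fun i => MeasurableSpace.comap (U i) inferInstance)
        (show k ∈ Set.Iio (k + 1) from Nat.lt_succ_self k)
    have e : S p U (k + 1) = fun ω => if U k ω < c p (S p U k ω)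
        then move (S p U k ω) ((S p U k ω).1 + 1)
        else move (S p U k ω) ((S p U k ω).1 - 1) := by
      funext ω; rfl
    rw [e]
    have hc : Measurable (c p) := measurable_of_countable _
    have hu : Measurable (fun s : St => move s (s.1 + 1)) := measurable_of_countable _
    have hd : Measurable (fun s : St => move s (s.1 - 1)) := measurable_of_countable _
    exact Measurable.ite (measurableSet_lt h2 (hc.comp h1)) (hu.comp h1) (hd.comp h1)

lemma int_ind [MeasurableSpace Ω] (μ : Measure Ω) (V : Ω → ℝ) (hV : Measurable V)
    (hU : Measure.map V μ = volume.restrict (Set.Icc (0 : ℝ) 1)) (a : ℝ) (ha0 : 0 < a)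
    (ha1 : a < 1) : ∫ ω, (Set.Iio a).indicator (fun _ => (1 : ℝ)) (V ω) ∂μ = a := by
  have e := integral_map (μ := μ) hV.aemeasurable
    (f := (Set.Iio a).indicator (fun _ => (1 : ℝ)))
    ((measurable_const.indicator measurableSet_Iio).aestronglyMeasurable)
  rw [← e, hU, integral_indicator measurableSet_Iio, integral_const, smul_eq_mul, mul_one,
    Measure.restrict_restrict measurableSet_Iio, measureReal_restrict_apply_univ]
  have : Set.Iio a ∩ Set.Icc (0 : ℝ) 1 = Set.Ico 0 a := by
    ext x
    simp only [Set.mem_inter_iff, Set.mem_Iio, Set.mem_Icc, Set.mem_Ico]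
    constructor
    · rintro ⟨h1, h2, h3⟩; exact ⟨h2, h1⟩
    · rintro ⟨h1, h2⟩; exact ⟨h2, h1, by linarith⟩
  rw [this]
  simp [Measure.real, ha0.le]

lemma S_measurable [MeasurableSpace Ω] (p : ℝ) (U : ℕ → Ω → ℝ) (hUmeas : ∀ n, Measurable (U n))
    (k : ℕ) : Measurable (S p U k) :=
  (S_meas p U k).mono (iSup₂_le fun i _ => (hUmeas i).comap_le) le_rfl

lemma S_indep [MeasurableSpace Ω] (μ : Measure Ω) [IsProbabilityMeasure μ] (p : ℝ)
    (U : ℕ → Ω → ℝ) (hUmeas : ∀ n, Measurable (U n)) (hUindep : iIndepFun U μ) (k : ℕ) :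
    IndepFun (S p U k) (U k) μ := by
  have := indep_iSup_of_disjoint (fun i => (hUmeas i).comap_le) hUindep
    (S := Set.Iio k) (T := {k}) (by simp)
  rw [IndepFun_iff_Indep]
  refine indep_of_indep_of_le_left (indep_of_indep_of_le_right this ?_) ?_
  · simp
  · exact (S_meas p U k).comap_le

lemma step_int [MeasurableSpace Ω] (μ : Measure Ω) [IsProbabilityMeasure μ] (p : ℝ)
    (hp0 : 0 < p) (hp1 : p < 1)
    (U : ℕ → Ω → ℝ) (hUmeas : ∀ n, Measurable (U n)) (hUindep : iIndepFun U μ)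
    (hUunif : ∀ n, Measure.map (U n) μ = volume.restrict (Set.Icc (0 : ℝ) 1)) (n k : ℕ) :
    ∫ ω, h p n (S p U (k + 1) ω) ∂μ =
      ∫ ω, h p n (S p U k ω) ∂μ - ∫ ω, sv n (S p U k ω) ∂μ := by
  set C := ((n : ℝ) + 1) * (n + 2) + n + 2 * (n : ℝ) ^ 2 with hC
  have hSm := S_measurable p U hUmeas k
  have hind := S_indep μ p U hUmeas hUindep k
  have integ : ∀ (G : St → ℝ) (K : ℝ), (∀ s, Inv s → |G s| ≤ K) →
      Integrable (fun ω => G (S p U k ω)) μ := by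
    intro G K hG
    have hGm : Measurable G := measurable_of_countable _
    refine Integrable.of_bound (hGm.comp hSm).aestronglyMeasurable K (ae_of_all _ fun ω => ?_)
    exact hG _ (inv_S p U k ω)
  let B : St → ℝ := fun s => h p n (move s (s.1 - 1))
  let D : St → ℝ := fun s => h p n (move s (s.1 + 1)) - h p n (move s (s.1 - 1))
  let R2 : St → ℝ := fun s => if s.2.2 = true then D s else 0
  let R3 : St → ℝ := fun s => if s.2.2 = true then 0 else D s
  have hB : ∀ s, Inv s → |B s| ≤ C := fun s _ => h_abs p hp0 hp1 n _ (inv_move _ _)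
  have hD : ∀ s, |D s| ≤ C + C := fun s => (abs_sub _ _).trans
    (add_le_add (h_abs p hp0 hp1 n _ (inv_move _ _)) (h_abs p hp0 hp1 n _ (inv_move _ _)))
  have hC0 : 0 ≤ C := by positivity
  have hR2 : ∀ s, Inv s → |R2 s| ≤ C + C := by
    intro s _
    simp only [R2]
    split_ifs
    · exact hD s
    · simp; linarith
  have hR3 : ∀ s, Inv s → |R3 s| ≤ C + C := by
    intro s _
    simp only [R3]
    split_ifs
    · simp; linarith
    · exact hD s
  let I : ℝ → ℝ → ℝ := fun a => (Set.Iio a).indicator (fun _ => (1 : ℝ))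
  have hIm : ∀ a, Measurable (I a) := fun a => measurable_const.indicator measurableSet_Iio
  have hIi : ∀ a, Integrable (fun ω => I a (U k ω)) μ := by
    intro a
    refine Integrable.of_bound ((hIm a).comp (hUmeas k)).aestronglyMeasurable 1
      (ae_of_all _ fun ω => ?_)
    simp only [I, Set.indicator]
    split_ifs <;> simp
  have prodI : ∀ (G : St → ℝ) (K a : ℝ), (∀ s, Inv s → |G s| ≤ K) → 0 < a → a < 1 →
      Integrable (fun ω => G (S p U k ω) * I a (U k ω)) μ ∧
      ∫ ω, G (S p U k ω) * I a (U k ω) ∂μ = ∫ ω, G (S p U k ω) * a ∂μ := by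
    intro G K a hG ha0 ha1
    have hGm : Measurable G := measurable_of_countable _
    have hi := hind.comp hGm (hIm a)
    refine ⟨hi.integrable_mul (integ G K hG) (hIi a), ?_⟩
    have := hi.integral_fun_mul_eq_mul_integral (integ G K hG).aestronglyMeasurable
      (hIi a).aestronglyMeasurable
    simp only [Function.comp] at this
    rw [this, int_ind μ (U k) (hUmeas k) (hUunif k) a ha0 ha1, integral_mul_const]
  have e1 : ∀ ω, h p n (S p U (k + 1) ω) = B (S p U k ω) + R2 (S p U k ω) * I p (U k ω)
      + R3 (S p U k ω) * I (1 / 2) (U k ω) := by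
    intro ω
    simp only [S]
    generalize S p U k ω = s
    simp only [B, R2, R3, D, I, c, Set.indicator, Set.mem_Iio]
    by_cases hb : s.2.2 = true
    · simp only [hb, if_true]
      split_ifs <;> simp
    · simp only [hb, if_false]
      split_ifs <;> simp
  obtain ⟨p1, p2⟩ := prodI R2 _ p hR2 hp0 hp1
  obtain ⟨p3, p4⟩ := prodI R3 _ (1 / 2) hR3 (by norm_num) (by norm_num)
  have iB := integ B _ hB
  have i2 := (integ R2 _ hR2).mul_const p
  have i3 := (integ R3 _ hR3).mul_const (1 / 2)
  have ih := integ (h p n) _ (h_abs p hp0 hp1 n)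
  have isv := integ (sv n) 1 (by intro s _; unfold sv; split_ifs <;> simp)
  simp only [e1]
  have q1 := integral_add (iB.add p1) p3
  have q2 := integral_add (iB.add i2) i3
  simp only [Pi.add_apply] at q1 q2
  rw [q1, integral_add iB p1, p2, p4, ← integral_add iB i2, ← q2, ← integral_sub ih isv]
  refine integral_congr_ae (ae_of_all _ fun ω => ?_)
  have := harmonic p n (S p U k ω) (inv_S p U k ω)
  simp only
  rw [← this]
  generalize S p U k ω = s
  simp only [B, R2, R3, D, c]
  split_ifs <;> ring

end prob
end ExcWalk

open ExcWalk

/-- The 1-excited random walk on the half-line with reflecting origin: `X_0 = 0`; when the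
walk sits on a never-before-visited site (which then contains a cookie, i.e. `n = 0` or
`X_n > max{X_m : m < n}`) the next step is right with probability `p` and left (truncated at
the origin) otherwise; on previously-visited (cookie-free) sites both steps have probability
`1/2`. Then the first hitting time `t_n` of site `n ≥ 1` is a.s. finite, with mean
`E[t_n] = 2qn² + n`, where `q = 1 - p`. -/
theorem excited_walk_half_line_hitting_time
    (p : ℝ) (hp0 : 0 < p) (hp1 : p < 1)
    {Ω : Type*} [MeasurableSpace Ω] (μ : Measure Ω) [IsProbabilityMeasure μ]
    (U : ℕ → Ω → ℝ) (hUmeas : ∀ n, Measurable (U n))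
    (hUindep : iIndepFun U μ)
    (hUunif : ∀ n, Measure.map (U n) μ = volume.restrict (Set.Icc (0 : ℝ) 1))
    (X : ℕ → Ω → ℕ) (hX0 : ∀ ω, X 0 ω = 0)
    (hXstep : ∀ n ω, X (n + 1) ω =
      if n = 0 ∨ ∀ m < n, X m ω < X n ω then
        (if U n ω < p then X n ω + 1 else X n ω - 1)
      else
        (if U n ω < 1 / 2 then X n ω + 1 else X n ω - 1)) :
    ∀ n : ℕ, 1 ≤ n →
      (∀ᵐ ω ∂μ, ∃ m, X m ω = n) ∧
      ∫ ω, ((sInf {m | X m ω = n} : ℕ) : ℝ) ∂μ = 2 * (1 - p) * (n : ℝ) ^ 2 + n := by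
  intro n hn
  have spec := fun ω k => S_spec p U X hX0 hXstep ω k
  set C := ((n : ℝ) + 1) * (n + 2) + n + 2 * (n : ℝ) ^ 2 with hC
  have svi : ∀ k, Integrable (fun ω => sv n (S p U k ω)) μ := by
    intro k
    have hm : Measurable (sv n) := measurable_of_countable _
    refine Integrable.of_bound (hm.comp (S_measurable p U hUmeas k)).aestronglyMeasurable 1
      (ae_of_all _ fun ω => ?_)
    simp only [Function.comp, sv]
    split_ifs <;> simp
  have hi : ∀ k, Integrable (fun ω => h p n (S p U k ω)) μ := by
    intro k
    have hm : Measurable (h p n) := measurable_of_countable _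
    exact Integrable.of_bound (hm.comp (S_measurable p U hUmeas k)).aestronglyMeasurable C
      (ae_of_all _ fun ω => h_abs p hp0 hp1 n _ (inv_S p U k ω))
  have sv0 : ∀ s, 0 ≤ sv n s := by intro s; unfold sv; split_ifs <;> simp
  let a : ℕ → ℝ := fun k => ∫ ω, sv n (S p U k ω) ∂μ
  let b : ℕ → ℝ := fun k => ∫ ω, h p n (S p U k ω) ∂μ
  have ha0 : ∀ k, 0 ≤ a k := fun k => integral_nonneg fun ω => sv0 _
  have hb0 : ∀ k, 0 ≤ b k := fun k => integral_nonneg fun ω =>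
    (h_bounds p hp0 hp1 n _ (inv_S p U k ω)).1
  have hba : ∀ k, b k ≤ C * a k := by
    intro k
    simp only [a, b]
    rw [← integral_const_mul]
    exact integral_mono (hi k) ((svi k).const_mul C) fun ω =>
      (h_bounds p hp0 hp1 n _ (inv_S p U k ω)).2
  have hstep : ∀ k, b (k + 1) = b k - a k := fun k =>
    step_int μ p hp0 hp1 U hUmeas hUindep hUunif n k
  have hsum : ∀ k, ∑ i ∈ Finset.range k, a i = b 0 - b k := by
    intro k
    induction k with
    | zero => simp
    | succ k ih => rw [Finset.sum_range_succ, ih, hstep]; ring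
  have hb00 : b 0 = 2 * (1 - p) * (n : ℝ) ^ 2 + n := by
    simp only [b, S, h, F]
    rw [if_pos (by omega)]
    simp
    ring
  have hsm : Summable a := summable_of_sum_range_le ha0 (c := b 0) fun k => by
    rw [hsum]; linarith [hb0 k]
  have hat : Filter.Tendsto a Filter.atTop (nhds 0) := hsm.tendsto_atTop_zero
  have hbt : Filter.Tendsto b Filter.atTop (nhds 0) := by
    refine squeeze_zero hb0 hba ?_
    simpa using hat.const_mul C
  have hHS : HasSum a (b 0) := by
    have h1 := hsm.hasSum.tendsto_sum_nat
    have h2 : Filter.Tendsto (fun k => ∑ i ∈ Finset.range k, a i) Filter.atTop (nhds (b 0)) := by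
      simp only [hsum]
      simpa using hbt.const_sub (b 0)
    rw [← tendsto_nhds_unique h1 h2]
    exact hsm.hasSum
  have hsv : ∀ ω k, (S p U k ω).2.1 < n ↔ ∀ m ≤ k, X m ω ≠ n := by
    intro ω k
    obtain ⟨-, i2, i3, -⟩ := spec ω k
    constructor
    · intro hlt m hm heq
      have := i2 m hm
      omega
    · intro hall
      by_contra hge
      obtain ⟨m, hm, he⟩ := i3 n (by omega)
      exact hall m hm he
  have hae : ∀ᵐ ω ∂μ, ∃ m, X m ω = n := by
    rw [ae_iff]
    have hreal : ∀ k, μ.real {ω | ¬ ∃ m, X m ω = n} ≤ a k := by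
      intro k
      have hms : MeasurableSet {ω | (S p U k ω).2.1 < n} := by
        have : MeasurableSet {s : St | s.2.1 < n} := MeasurableSet.of_discrete
        exact (S_measurable p U hUmeas k) this
      have e : a k = μ.real {ω | (S p U k ω).2.1 < n} := by
        rw [← integral_indicator_one hms]
        refine integral_congr_ae (ae_of_all _ fun ω => ?_)
        simp [sv, Set.indicator]
      rw [e]
      refine measureReal_mono ?_
      intro ω hω
      simp only [Set.mem_ofPred_eq, not_exists] at hω ⊢
      exact (hsv ω k).2 fun m _ => hω m
    have h0 : μ.real {ω | ¬ ∃ m, X m ω = n} ≤ 0 := ge_of_tendsto' hat hreal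
    have h1 : μ.real {ω | ¬ ∃ m, X m ω = n} = 0 := le_antisymm h0 measureReal_nonneg
    exact (measureReal_eq_zero_iff).1 h1
  refine ⟨hae, ?_⟩
  have hs := hasSum_integral_of_summable_integral_norm (F := fun k ω => sv n (S p U k ω)) svi
    (by
      refine hsm.congr fun k => ?_
      refine integral_congr_ae (ae_of_all _ fun ω => ?_)
      simp only [Real.norm_eq_abs]
      rw [abs_of_nonneg (sv0 _)])
  rw [← hb00, hHS.unique hs]
  refine integral_congr_ae ?_
  filter_upwards [hae] with ω hω
  have hne : {m | X m ω = n}.Nonempty := hω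
  set T := sInf {m | X m ω = n} with hT
  have hk : ∀ k, sv n (S p U k ω) = if k < T then 1 else 0 := by
    intro k
    unfold sv
    refine if_congr ?_ rfl rfl
    rw [hsv]
    constructor
    · intro hall
      by_contra hge
      exact hall T (by omega) (Nat.sInf_mem hne)
    · intro hlt m hm he
      have : T ≤ m := Nat.sInf_le he
      omega
  simp only [hk]
  rw [tsum_eq_sum (s := Finset.range T) (by intro k hk; simp at hk; simp; omega)]
  rw [Finset.sum_congr rfl (g := fun _ => (1 : ℝ)) (by intro k hk; simp at hk; simp [hk])]
  simp
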